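/- Let b be a finite tuple in N and let p↾L(x) be the parameter-free L-type of b. Then there is a homeomorphism h : D_b → [p↾L(x)]_S ⊆ S_x^Y sending diag↾1(α,b) to {φ(x) : φ(b) ∈ diag↾1(α,b)}; moreover, for every existential quasifinite formula π(x) containing p↾L(x), the image under h of [π(b)]_D is [π(x)]_S. -/

import Mathlib

open FirstOrder FirstOrder.Language

namespace GenExp

/-- The type of expansions of the `L`-structure `N` to the language `L.sum L'`:
an expansion is an interpretation of the new symbols, i.e. an `L'`-structure on `N`. -/
def Expansions (L L' : FirstOrder.Language.{0,0}) (N : Type) [L.Structure N] : Type :=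
  L'.Structure N

variable {L L' : FirstOrder.Language.{0,0}} {N : Type} [L.Structure N]

/-- The underlying `L'`-structure of an expansion. -/
def Expansions.str (σ : Expansions L L' N) : L'.Structure N := σ

/-- The `(L.sum L')`-structure on `N` determined by an expansion. -/
def Expansions.str0 (σ : Expansions L L' N) : (L.sum L').Structure N :=
  letI := σ.str
  inferInstance

/-- `(N, σ)` realizes the `L₀`-formula `φ` at the tuple `c` of parameters. -/
def Expansions.Realizes (σ : Expansions L L' N) {n : ℕ}
    (φ : (L.sum L').Formula (Fin n)) (c : Fin n → N) : Prop :=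
  letI := σ.str0
  φ.Realize c

/-- `(N, σ)` is a model of the `L₀`-theory `T₀`. -/
def Expansions.ModelsTh (σ : Expansions L L' N) (T₀ : (L.sum L').Theory) : Prop :=
  letI := σ.str0
  N ⊨ T₀

/-- The topology on `Exp(N)` generated by the sets `[φ]_N` for quantifier-free
`L₀`-sentences `φ` with parameters in `N` (coded as formulas plus an assignment). -/
instance (L L' : FirstOrder.Language.{0,0}) (N : Type) [L.Structure N] :
    TopologicalSpace (Expansions L L' N) :=
  TopologicalSpace.generateFrom
    {s | ∃ (n : ℕ) (φ : (L.sum L').Formula (Fin n)) (c : Fin n → N),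
      φ.IsQF ∧ s = {σ : Expansions L L' N | σ.Realizes φ c}}

/-- `Exp(N, T₀)`, as a subset of `Exp(N)`. -/
def ExpSet (L L' : FirstOrder.Language.{0,0}) (N : Type) [L.Structure N] (T₀ : (L.sum L').Theory) :
    Set (Expansions L L' N) :=
  {σ | σ.ModelsTh T₀}

/-- An `L₀`-sentence is universal modulo `T` if it is equivalent to a universal sentence
in every model of `T`. -/
def UniversalModulo (L L' : FirstOrder.Language.{0,0}) (T : L.Theory) (φ : (L.sum L').Sentence) : Prop :=
  ∃ ψ : (L.sum L').Sentence, BoundedFormula.IsUniversal ψ ∧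
    ∀ (U : Type) [L.Structure U] [L'.Structure U], U ⊨ T → (U ⊨ φ ↔ U ⊨ ψ)

/-- A theory is universal modulo `T` if all its sentences are. -/
def UniversalTheoryModulo (L L' : FirstOrder.Language.{0,0}) (T : L.Theory)
    (T₀ : (L.sum L').Theory) : Prop :=
  ∀ φ ∈ T₀, UniversalModulo L L' T φ

/-- `T` has quantifier elimination. -/
def HasQE (L : FirstOrder.Language.{0,0}) (T : L.Theory) : Prop :=
  ∀ (n : ℕ) (φ : L.Formula (Fin n)), ∃ ψ : L.Formula (Fin n), ψ.IsQF ∧ T ⊨ᵇ φ.iff ψ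

/-- `T` is small: countably many complete `n`-types for every `n`. -/
def IsSmall (L : FirstOrder.Language.{0,0}) (T : L.Theory) : Prop :=
  ∀ n : ℕ, Countable (T.CompleteType (Fin n))

/-- `N` is (ω-)saturated: every finitely realized set of `L`-formulas in one variable
with finitely many parameters in `N` is realized in `N`. -/
def IsSaturated (L : FirstOrder.Language.{0,0}) (N : Type) [L.Structure N] : Prop :=
  ∀ (k : ℕ) (c : Fin k → N) (p : Set (L.Formula (Fin k ⊕ Fin 1))),
    (∀ s : Finset (L.Formula (Fin k ⊕ Fin 1)), ↑s ⊆ p →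
      ∃ x : N, ∀ φ ∈ s, φ.Realize (Sum.elim c fun _ => x)) →
    ∃ x : N, ∀ φ ∈ p, φ.Realize (Sum.elim c fun _ => x)

/-- `σ` is an existentially closed expansion: every quantifier-free `L₀`-formula with
parameters in `N` that has a solution in some model of `T₀` extending `(N, σ)` has a
solution in `(N, σ)`. -/
def Expansions.IsEC (σ : Expansions L L' N) (T₀ : (L.sum L').Theory) : Prop :=
  letI := σ.str0
  ∀ (k n : ℕ) (φ : (L.sum L').Formula (Fin k ⊕ Fin n)) (c : Fin k → N), φ.IsQF →
    (∃ (U : Type) (iU : L.Structure U) (iU' : L'.Structure U),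
      letI := iU; letI := iU';
      ∃ _j : N ↪[L.sum L'] U, (U ⊨ T₀) ∧ ∃ x : Fin n → U, φ.Realize (Sum.elim (_j ∘ c) x)) →
    ∃ x : Fin n → N, φ.Realize (Sum.elim c x)

/-- `σ` is a smooth expansion: it realizes every finitely consistent type of the form
`p↾L(x) ∪ {ψ(x)}` with `ψ` quantifier-free in `L₀` and `p↾L` an `L`-type with finitely
many parameters. -/
def Expansions.IsSmooth (σ : Expansions L L' N) : Prop :=
  letI := σ.str0
  ∀ (k n : ℕ) (c : Fin k → N) (p : Set (L.Formula (Fin k ⊕ Fin n)))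
    (ψ : (L.sum L').Formula (Fin k ⊕ Fin n)), ψ.IsQF →
    (∀ s : Finset (L.Formula (Fin k ⊕ Fin n)), ↑s ⊆ p →
      ∃ x : Fin n → N, ψ.Realize (Sum.elim c x) ∧
        ∀ χ ∈ s, Formula.Realize (L := L) (M := N) χ (Sum.elim c x)) →
    ∃ x : Fin n → N, ψ.Realize (Sum.elim c x) ∧
      ∀ χ ∈ p, Formula.Realize (L := L) (M := N) χ (Sum.elim c x)

/-- The set `Y` of smooth existentially closed expansions in `Exp(N, T₀)`. -/
def YSet (L L' : FirstOrder.Language.{0,0}) (N : Type) [L.Structure N] (T₀ : (L.sum L').Theory) :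
    Set (Expansions L L' N) :=
  {σ | σ.ModelsTh T₀ ∧ σ.IsSmooth ∧ σ.IsEC T₀}


/-- A general existentially closed model of `T₀` (in the class of models of `T₀`). -/
def IsECModel (L L' : FirstOrder.Language.{0,0}) (T₀ : (L.sum L').Theory)
    (U : Type) [L.Structure U] [L'.Structure U] : Prop :=
  (U ⊨ T₀) ∧
  ∀ (k n : ℕ) (φ : (L.sum L').Formula (Fin k ⊕ Fin n)) (c : Fin k → U), φ.IsQF →
    (∃ (V : Type) (iV : L.Structure V) (iV' : L'.Structure V),
      letI := iV; letI := iV';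
      ∃ _j : U ↪[L.sum L'] V, (V ⊨ T₀) ∧ ∃ x : Fin n → V, φ.Realize (Sum.elim (_j ∘ c) x)) →
    ∃ x : Fin n → U, φ.Realize (Sum.elim c x)

/-- All existentially closed models of `T₀` have the same existential theory. -/
def SameExistentialTheory (L L' : FirstOrder.Language.{0,0}) (T₀ : (L.sum L').Theory) : Prop :=
  ∀ (U : Type) [L.Structure U] [L'.Structure U] (V : Type) [L.Structure V] [L'.Structure V],
    IsECModel L L' T₀ U → IsECModel L L' T₀ V →
    ∀ φ : (L.sum L').Sentence, BoundedFormula.IsExistential φ → ((U ⊨ φ) ↔ (V ⊨ φ))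

/-- An existential quasifinite formula `∃ y (p(x,y) ∧ φ(x,y))`, where `p` is a
parameter-free `L`-type and `φ` is a quantifier-free `L₀`-formula. -/
structure EQF (L L' : FirstOrder.Language.{0,0}) (n : ℕ) : Type where
  m : ℕ
  p : Set (L.Formula (Fin n ⊕ Fin m))
  φ : (L.sum L').Formula (Fin n ⊕ Fin m)
  qf : φ.IsQF

/-- Realization of an existential quasifinite formula at a tuple `b` in `(N, σ)`. -/
def EQF.RealizeAt {n : ℕ} (π : EQF L L' n) (σ : Expansions L L' N) (b : Fin n → N) : Prop :=
  letI := σ.str0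
  ∃ y : Fin π.m → N,
    (∀ χ ∈ π.p, Formula.Realize (L := L) (M := N) χ (Sum.elim b y)) ∧
      π.φ.Realize (Sum.elim b y)

/-- The complete parameter-free `L₀`-type of the tuple `a` in `(N, σ)`. -/
def fullType (σ : Expansions L L' N) {n : ℕ} (a : Fin n → N) :
    Set ((L.sum L').Formula (Fin n)) :=
  {φ | σ.Realizes φ a}

/-- `p↾1`: the universal and existential formulas in `p`. -/
def restr1 {L L' : FirstOrder.Language.{0,0}} {n : ℕ}
    (p : Set ((L.sum L').Formula (Fin n))) : Set ((L.sum L').Formula (Fin n)) :=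
  {φ ∈ p | BoundedFormula.IsUniversal φ ∨ BoundedFormula.IsExistential φ}

/-- The 1-diagram of `σ` at `b`: all universal and existential formulas satisfied by `b`
in `(N, σ)` (coding sentences with parameters `b` as formulas). -/
def diag1 (σ : Expansions L L' N) {n : ℕ} (b : Fin n → N) :
    Set ((L.sum L').Formula (Fin n)) :=
  restr1 (fullType σ b)

variable (L L' N) in
/-- The set `D_b` of 1-diagrams at `b` of expansions in `Y`. -/
def DSet (T₀ : (L.sum L').Theory) {n : ℕ} (b : Fin n → N) :
    Set (Set ((L.sum L').Formula (Fin n))) :=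
  {d | ∃ σ ∈ YSet L L' N T₀, d = diag1 σ b}

variable (L L' N) in
/-- The basic subset `[π(b)]_D` of `D_b`. -/
def DBasic (T₀ : (L.sum L').Theory) {n : ℕ} (b : Fin n → N) (π : EQF L L' n) :
    Set (Set ((L.sum L').Formula (Fin n))) :=
  {d | ∃ σ ∈ YSet L L' N T₀, d = diag1 σ b ∧ π.RealizeAt σ b}

variable (L L' N) in
/-- The topology on `D_b` generated by the sets `[π(b)]_D`. -/
def DTop (T₀ : (L.sum L').Theory) {n : ℕ} (b : Fin n → N) :
    TopologicalSpace ↥(DSet L L' N T₀ b) :=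
  TopologicalSpace.generateFrom
    {s | ∃ π : EQF L L' n, s = {d | ↑d ∈ DBasic L L' N T₀ b π}}

variable (L L' N) in
/-- The set `S_x^Y` of types `p↾1` for `p` a complete parameter-free type realized in `Y`. -/
def SSet (T₀ : (L.sum L').Theory) (n : ℕ) : Set (Set ((L.sum L').Formula (Fin n))) :=
  {q | ∃ σ ∈ YSet L L' N T₀, ∃ a : Fin n → N, q = diag1 σ a}

variable (L L' N) in
/-- The basic subset `[π(x)]_S` of `S_x^Y`. -/
def SBasic (T₀ : (L.sum L').Theory) {n : ℕ} (π : EQF L L' n) :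
    Set (Set ((L.sum L').Formula (Fin n))) :=
  {q | ∃ σ ∈ YSet L L' N T₀, ∃ a : Fin n → N, q = diag1 σ a ∧ π.RealizeAt σ a}

variable (L L' N) in
/-- The topology on `S_x^Y` generated by the sets `[π(x)]_S`. -/
def STop (T₀ : (L.sum L').Theory) (n : ℕ) : TopologicalSpace ↥(SSet L L' N T₀ n) :=
  TopologicalSpace.generateFrom
    {s | ∃ π : EQF L L' n, s = {q | ↑q ∈ SBasic L L' N T₀ π}}

variable (L L' N) in
/-- `α` is an e-atomic expansion: it is in `Y` and each of its 1-diagrams is an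
isolated point of `D_b`. -/
def IsEAtomic (T₀ : (L.sum L').Theory) (α : Expansions L L' N) : Prop :=
  α ∈ YSet L L' N T₀ ∧ ∀ (n : ℕ) (b : Fin n → N),
    @IsOpen _ (DTop L L' N T₀ b) {d | (d : Set ((L.sum L').Formula (Fin n))) = diag1 α b}

/-- The conjugate expansion `σ^g` of `σ` under an automorphism `g` of `N`. -/
def conjExp (g : N ≃[L] N) (σ : Expansions L L' N) : Expansions L L' N :=
  show L'.Structure N from
  { funMap := fun {_} F a => g ((σ.str).funMap F fun i => g.symm (a i))
    RelMap := fun {_} R a => (σ.str).RelMap R fun i => g.symm (a i) }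

variable (L L' N) in
/-- `τ` is Truss generic: its conjugacy class is comeagre in `Exp(N, T₀)`. -/
def IsTrussGeneric (T₀ : (L.sum L').Theory) (τ : Expansions L L' N) : Prop :=
  τ.ModelsTh T₀ ∧
    {σ : ↥(ExpSet L L' N T₀) | ∃ g : N ≃[L] N, (σ : Expansions L L' N) = conjExp g τ} ∈
      residual ↥(ExpSet L L' N T₀)


variable (L L' N) in
/-- The quantifier-free formula `φ` (with parameters `c`) has a solution in `(N, σ)`. -/
def SolvableIn (σ : Expansions L L' N) {k n : ℕ}
    (φ : (L.sum L').Formula (Fin k ⊕ Fin n)) (c : Fin k → N) : Prop :=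
  letI := σ.str0
  ∃ x : Fin n → N, φ.Realize (Sum.elim c x)

variable (L L' N) in
/-- The formula `φ` (with parameters `c`) has a solution in some model of `T₀`
extending `(N, σ)`. -/
def SolvableInExtension (T₀ : (L.sum L').Theory) (σ : Expansions L L' N) {k n : ℕ}
    (φ : (L.sum L').Formula (Fin k ⊕ Fin n)) (c : Fin k → N) : Prop :=
  letI := σ.str0
  ∃ (U : Type) (iU : L.Structure U) (iU' : L'.Structure U),
    letI := iU; letI := iU';
    ∃ _j : N ↪[L.sum L'] U, (U ⊨ T₀) ∧ ∃ x : Fin n → U, φ.Realize (Sum.elim (_j ∘ c) x)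

variable (L L' N) in
/-- The parameter-free `L`-type of the tuple `b`, viewed as an existential quasifinite
formula (with no existential quantifiers and trivial quantifier-free part). -/
def pLEQF {n : ℕ} (b : Fin n → N) : EQF L L' n where
  m := 0
  p := (Formula.relabel Sum.inl) ''
    {χ : L.Formula (Fin n) | Formula.Realize (L := L) (M := N) χ b}
  φ := ⊤
  qf := BoundedFormula.IsQF.top

lemma SBasic_subset_SSet (T₀ : (L.sum L').Theory) {n : ℕ} (π : EQF L L' n) :
    SBasic L L' N T₀ π ⊆ SSet L L' N T₀ n := by
  rintro q ⟨σ, hσ, a, rfl, -⟩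
  exact ⟨σ, hσ, a, rfl⟩

variable (L L' N) in
/-- The basic set `[π(x)]_S`, topologized as a subspace of `S_x^Y`. -/
def SBasicTop (T₀ : (L.sum L').Theory) {n : ℕ} (π : EQF L L' n) :
    TopologicalSpace ↥(SBasic L L' N T₀ π) :=
  TopologicalSpace.induced (Set.inclusion (SBasic_subset_SSet T₀ π)) (STop L L' N T₀ n)

/-- A binary relation on `N`, given as a set of pairs, is partial elementary if the two
projections of every finite family of its elements satisfy the same `L`-formulas. -/
def PartialElementary (L : FirstOrder.Language.{0,0}) {N : Type} [L.Structure N]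
    (S : Set (N × N)) : Prop :=
  ∀ (k : ℕ) (z : Fin k → N × N), (∀ i, z i ∈ S) → ∀ φ : L.Formula (Fin k),
    φ.Realize (fun i => (z i).1) ↔ φ.Realize (fun i => (z i).2)

lemma PartialElementary.realize_iff {S : Set (N × N)} (hS : PartialElementary L S)
    {α : Type} [Finite α] (z : α → N × N) (hz : ∀ i, z i ∈ S) (φ : L.Formula α) :
    φ.Realize (fun i => (z i).1) ↔ φ.Realize (fun i => (z i).2) := by
  obtain ⟨k, ⟨e⟩⟩ := Finite.exists_equiv_fin α
  have h := hS k (z ∘ e.symm) (fun i => hz _) (φ.relabel e)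
  simpa [Formula.realize_relabel, Function.comp_def] using h

lemma PartialElementary.swap {S : Set (N × N)} (hS : PartialElementary L S) :
    PartialElementary L (Prod.swap ⁻¹' S) := by
  intro k z hz φ
  simpa using (hS k (fun i => (z i).swap) hz φ).symm

/-- In a saturated structure, finite partial elementary relations can be extended forward. -/
lemma PartialElementary.exists_insert (hsat : IsSaturated L N) {S : Set (N × N)}
    (hfin : S.Finite) (hS : PartialElementary L S) (x : N) :
    ∃ y, PartialElementary L (insert (x, y) S) := by
  have := hfin.to_subtype
  obtain ⟨k, ⟨e⟩⟩ := Finite.exists_equiv_fin S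
  set z : Fin k → N × N := fun i => (e.symm i : N × N) with hz
  have hzS : ∀ i, z i ∈ S := fun i => (e.symm i).2
  obtain ⟨y, hy⟩ := hsat k (fun i => (z i).2)
    {φ | φ.Realize (Sum.elim (fun i => (z i).1) fun _ => x)} (by
      intro s hs
      let ψ : L.Formula (Fin k) :=
        Formula.iExs (Fin 1) (Formula.iInf fun φ : s => (φ : L.Formula (Fin k ⊕ Fin 1)))
      have hψ : ψ.Realize fun i => (z i).1 :=
        Formula.realize_iExs.2 ⟨fun _ => x, Formula.realize_iInf.2 fun φ => hs φ.2⟩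
      obtain ⟨w, hw⟩ := Formula.realize_iExs.1 ((hS.realize_iff z hzS ψ).1 hψ)
      have hw' : w = fun _ => w 0 := by
        funext i
        rw [Subsingleton.elim i 0]
      refine ⟨w 0, fun φ hφ => ?_⟩
      rw [← hw']
      exact Formula.realize_iInf.1 hw ⟨φ, hφ⟩)
  have hiff : ∀ φ : L.Formula (Fin k ⊕ Fin 1),
      φ.Realize (Sum.elim (fun i => (z i).1) fun _ => x) ↔
        φ.Realize (Sum.elim (fun i => (z i).2) fun _ => y) := by
    intro φ
    refine ⟨hy φ, fun h => ?_⟩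
    by_contra hn
    exact (Formula.realize_not.1 (hy φ.not (Formula.realize_not.2 hn))) h
  refine ⟨y, fun m w hw φ => ?_⟩
  have hr : ∀ i, ∃ r : Fin k ⊕ Fin 1, w i = Sum.elim z (fun _ => (x, y)) r := by
    intro i
    rcases hw i with h | h
    · exact ⟨Sum.inr 0, h⟩
    · exact ⟨Sum.inl (e ⟨w i, h⟩), by simp [hz]⟩
  choose r hr using hr
  have h := hiff (φ.relabel r)
  rw [Formula.realize_relabel, Formula.realize_relabel] at h
  convert h using 2
  · funext i
    rw [hr i]
    cases h : r i <;> simp [h]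
  · funext i
    rw [hr i]
    cases h : r i <;> simp [h]

/-- A partial elementary relation which is total on both sides is the graph of an automorphism. -/
lemma PartialElementary.exists_equiv {F : Set (N × N)} (hF : PartialElementary L F)
    (hl : ∀ x, ∃ y, (x, y) ∈ F) (hr : ∀ y, ∃ x, (x, y) ∈ F) :
    ∃ g : N ≃[L] N, ∀ p ∈ F, g p.1 = p.2 := by
  have heq : ∀ p ∈ F, ∀ q ∈ F, p.1 = q.1 ↔ p.2 = q.2 := by
    intro p hp q hq
    have h := hF.realize_iff ![p, q] (fun i => by fin_cases i <;> simpa)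
      (Term.equal (Term.var 0) (Term.var 1))
    simpa [Formula.realize_equal] using h
  choose f hf using hl
  choose f' hf' using hr
  refine ⟨{ toFun := f, invFun := f', left_inv := fun x => ?_, right_inv := fun y => ?_,
            map_fun' := fun {n} s x => ?_, map_rel' := fun {n} R x => ?_ }, fun p hp => ?_⟩
  · exact (heq _ (hf' (f x)) _ (hf x)).2 rfl
  · exact (heq _ (hf (f' y)) _ (hf' y)).1 rfl
  · have h := hF.realize_iff
      (Sum.elim (fun i : Fin n => (x i, f (x i))) fun _ : Fin 1 => (Structure.funMap s x, f (Structure.funMap s x)))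
      (by rintro (i | i) <;> exact hf _)
      (Term.equal (Term.func s fun i => Term.var (Sum.inl i)) (Term.var (Sum.inr 0)))
    simp only [Formula.realize_equal, Term.realize_func, Term.realize_var, Sum.elim_inl,
      Sum.elim_inr] at h
    exact (h.1 trivial).symm
  · have h := hF.realize_iff (fun i : Fin n => (x i, f (x i))) (fun i => hf _)
      (R.formula fun i => Term.var i)
    simp only [Formula.realize_rel, Term.realize_var] at h
    exact h.symm
  · exact (heq _ (hf p.1) _ hp).1 rfl

/-- Countable saturated structures are homogeneous. -/
lemma exists_equiv_of_realize_iff [Countable N] (hsat : IsSaturated L N) {n : ℕ}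
    (a b : Fin n → N) (hab : ∀ χ : L.Formula (Fin n), χ.Realize a ↔ χ.Realize b) :
    ∃ g : N ≃[L] N, g ∘ a = b := by
  let P := {S : Set (N × N) // S.Finite ∧ PartialElementary L S}
  let S₀ : P := ⟨Set.range fun i => (a i, b i), Set.finite_range _, by
    intro k z hz φ
    choose r hr using hz
    have h := hab (φ.relabel r)
    rw [Formula.realize_relabel, Formula.realize_relabel] at h
    simpa [← hr, Function.comp_def] using h⟩
  let D : N ⊕ N → Order.Cofinal P := Sum.elim
    (fun x =>
      { carrier := {S | ∃ y, (x, y) ∈ S.1}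
        isCofinal := fun S => by
          obtain ⟨y, hy⟩ := S.2.2.exists_insert hsat S.2.1 x
          exact ⟨⟨_, S.2.1.insert _, hy⟩, ⟨y, Set.mem_insert _ _⟩, Set.subset_insert _ _⟩ })
    (fun y =>
      { carrier := {S | ∃ x, (x, y) ∈ S.1}
        isCofinal := fun S => by
          obtain ⟨x, hx⟩ := S.2.2.swap.exists_insert hsat
            (S.2.1.preimage Prod.swap_injective.injOn) y
          exact ⟨⟨_, ((S.2.1.preimage Prod.swap_injective.injOn).insert _).preimage
            Prod.swap_injective.injOn, hx.swap⟩, ⟨x, Or.inl rfl⟩, fun p hp => Or.inr hp⟩ })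
  have := Encodable.ofCountable (N ⊕ N)
  let I := Order.idealOfCofinals S₀ D
  have hdir : ∀ k (z : Fin k → N × N), (∀ i, ∃ S ∈ I, z i ∈ S.1) →
      ∃ S ∈ I, ∀ i, z i ∈ S.1 := by
    intro k z hz
    classical
    obtain ⟨S, hS, hzS⟩ := DirectedOn.exists_mem_subset_of_finset_subset_biUnion
      (f := fun S : P => S.1) (s := Finset.univ.image z) I.nonempty I.directed (by
        intro p hp
        obtain ⟨i, -, rfl⟩ := Finset.mem_image.1 hp
        simpa using hz i)
    exact ⟨S, hS, fun i => hzS (by simp)⟩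
  obtain ⟨g, hg⟩ := PartialElementary.exists_equiv (L := L) (F := {p | ∃ S ∈ I, p ∈ S.1})
    (fun k z hz φ => by
      obtain ⟨S, -, hS⟩ := hdir k z hz
      exact S.2.2 k z hS φ)
    (fun x => by
      obtain ⟨S, ⟨y, hy⟩, hS⟩ := Order.cofinal_meets_idealOfCofinals S₀ D (Sum.inl x)
      exact ⟨y, S, hS, hy⟩)
    (fun y => by
      obtain ⟨S, ⟨x, hx⟩, hS⟩ := Order.cofinal_meets_idealOfCofinals S₀ D (Sum.inr y)
      exact ⟨x, S, hS, hx⟩)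
  exact ⟨g, funext fun i => hg (a i, b i) ⟨S₀, Order.mem_idealOfCofinals S₀ D, i, rfl⟩⟩

/-- The automorphism `g` as an isomorphism `(N, σ) → (N, σ^g)`. -/
def conjEquiv (g : N ≃[L] N) (σ : Expansions L L' N) :
    @Language.Equiv (L.sum L') N N σ.str0 (conjExp g σ).str0 :=
  @Language.Equiv.mk (L.sum L') N N σ.str0 (conjExp g σ).str0 g.toEquiv
    (by
      rintro n (f | f) x
      · exact g.map_fun f x
      · change g (σ.str.funMap f x) = g (σ.str.funMap f fun i => g.symm (g (x i)))
        simp)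
    (by
      rintro n (R | R) x
      · exact g.map_rel R x
      · change σ.str.RelMap R (fun i => g.symm (g (x i))) ↔ σ.str.RelMap R x
        simp)

lemma realize_comp_equiv {L₁ : FirstOrder.Language.{0,0}} {M M' : Type} [L₁.Structure M]
    [L₁.Structure M'] (e : M ≃[L₁] M') {α : Type} (φ : L₁.Formula α) (v : α → M) :
    φ.Realize (e ∘ v) ↔ φ.Realize v :=
  StrongHomClass.realize_formula e φ

lemma models_of_equiv {L₁ : FirstOrder.Language.{0,0}} {M M' : Type} [L₁.Structure M]
    [L₁.Structure M'] (e : M ≃[L₁] M') {T₁ : L₁.Theory} (h : M ⊨ T₁) : M' ⊨ T₁ :=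
  StrongHomClass.theory_model e

lemma realize_conjExp (g : N ≃[L] N) (σ : Expansions L L' N) {α : Type}
    (φ : (L.sum L').Formula α) (v : α → N) :
    @Formula.Realize (L.sum L') N (conjExp g σ).str0 α φ (g ∘ v) ↔
      @Formula.Realize (L.sum L') N σ.str0 α φ v :=
  @realize_comp_equiv (L.sum L') N N σ.str0 (conjExp g σ).str0 (conjEquiv g σ) α φ v

lemma realize_conjExp_elim (g : N ≃[L] N) (σ : Expansions L L' N) {α β : Type}
    (φ : (L.sum L').Formula (α ⊕ β)) (c : α → N) (x : β → N) :
    @Formula.Realize (L.sum L') N (conjExp g σ).str0 _ φ (Sum.elim (g ∘ c) (g ∘ x)) ↔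
      @Formula.Realize (L.sum L') N σ.str0 _ φ (Sum.elim c x) := by
  rw [← realize_conjExp g σ, Sum.comp_elim]

lemma realize_elim_comp (g : N ≃[L] N) {α β : Type}
    (φ : L.Formula (α ⊕ β)) (c : α → N) (x : β → N) :
    φ.Realize (Sum.elim (g ∘ c) (g ∘ x)) ↔ φ.Realize (Sum.elim c x) := by
  rw [← Sum.comp_elim]
  exact StrongHomClass.realize_formula g φ

lemma comp_symm_comp (g : N ≃[L] N) {α : Type} (c : α → N) : g ∘ (g.symm ∘ c) = c := by
  funext i
  simp

lemma diag1_conjExp (g : N ≃[L] N) (σ : Expansions L L' N) {n : ℕ} (a : Fin n → N) :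
    diag1 (conjExp g σ) (g ∘ a) = diag1 σ a := by
  ext φ
  exact and_congr_left' (realize_conjExp g σ φ a)

lemma EQF.realizeAt_conjExp {n : ℕ} (π : EQF L L' n) (g : N ≃[L] N) (σ : Expansions L L' N)
    {a : Fin n → N} (h : π.RealizeAt σ a) : π.RealizeAt (conjExp g σ) (g ∘ a) := by
  obtain ⟨y, hy, hφ⟩ := h
  exact ⟨g ∘ y, fun χ hχ => (realize_elim_comp g χ a y).2 (hy χ hχ),
    (realize_conjExp_elim g σ π.φ a y).2 hφ⟩

lemma Expansions.IsSmooth.conjExp {σ : Expansions L L' N} (h : σ.IsSmooth) (g : N ≃[L] N) :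
    (conjExp g σ).IsSmooth := by
  intro k n c p ψ hψ hs
  obtain ⟨x, hx, hxp⟩ := h k n (g.symm ∘ c) p ψ hψ (by
    intro s hsp
    obtain ⟨x, hx, hxs⟩ := hs s hsp
    rw [← comp_symm_comp g c, ← comp_symm_comp g x] at hx
    refine ⟨g.symm ∘ x, (realize_conjExp_elim g σ ψ _ _).1 hx, fun χ hχ => ?_⟩
    have h := hxs χ hχ
    rw [← comp_symm_comp g c, ← comp_symm_comp g x] at h
    exact (realize_elim_comp g χ _ _).1 h)
  refine ⟨g ∘ x, ?_, fun χ hχ => ?_⟩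
  · have h := (realize_conjExp_elim g σ ψ _ _).2 hx
    rwa [comp_symm_comp] at h
  · have h := (realize_elim_comp g χ _ _).2 (hxp χ hχ)
    rwa [comp_symm_comp] at h

lemma Expansions.IsEC.conjExp {T₀ : (L.sum L').Theory} {σ : Expansions L L' N}
    (h : σ.IsEC T₀) (g : N ≃[L] N) : (conjExp g σ).IsEC T₀ := by
  intro k n φ c hφ hU
  obtain ⟨U, iU, iU', j, hUT, x, hx⟩ := hU
  have hx' : φ.Realize (Sum.elim ((j ∘ g) ∘ (g.symm ∘ c)) x) := by
    rwa [Function.comp_assoc, comp_symm_comp]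
  obtain ⟨y, hy⟩ := h k n φ (g.symm ∘ c) hφ ⟨U, iU, iU',
    @Embedding.comp (L.sum L') N N σ.str0 (GenExp.conjExp g σ).str0 U _ j
      (@Language.Equiv.toEmbedding (L.sum L') N N σ.str0 (GenExp.conjExp g σ).str0
        (conjEquiv g σ)), hUT, x, hx'⟩
  have h := (realize_conjExp_elim g σ φ _ _).2 hy
  rw [comp_symm_comp] at h
  exact ⟨g ∘ y, h⟩

lemma Expansions.ModelsTh.conjExp {T₀ : (L.sum L').Theory} {σ : Expansions L L' N}
    (h : σ.ModelsTh T₀) (g : N ≃[L] N) : (conjExp g σ).ModelsTh T₀ :=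
  @models_of_equiv (L.sum L') N N σ.str0 (GenExp.conjExp g σ).str0 (conjEquiv g σ) T₀ h

lemma conjExp_mem_YSet {T₀ : (L.sum L').Theory} {σ : Expansions L L' N}
    (h : σ ∈ YSet L L' N T₀) (g : N ≃[L] N) : conjExp g σ ∈ YSet L L' N T₀ :=
  ⟨h.1.conjExp g, h.2.1.conjExp g, h.2.2.conjExp g⟩

lemma isAtomic_onBoundedFormula {L₁ L₂ : FirstOrder.Language.{0,0}} (f : L₁ →ᴸ L₂) {α : Type}
    {n : ℕ} {φ : L₁.BoundedFormula α n} (h : φ.IsAtomic) : (f.onBoundedFormula φ).IsAtomic := by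
  cases h
  · exact BoundedFormula.IsAtomic.equal _ _
  · exact BoundedFormula.IsAtomic.rel _ _

lemma isQF_onBoundedFormula {L₁ L₂ : FirstOrder.Language.{0,0}} (f : L₁ →ᴸ L₂) {α : Type}
    {n : ℕ} {φ : L₁.BoundedFormula α n} (h : φ.IsQF) : (f.onBoundedFormula φ).IsQF := by
  induction h with
  | falsum => exact BoundedFormula.IsQF.falsum
  | of_isAtomic h => exact (isAtomic_onBoundedFormula f h).isQF
  | imp _ _ h₁ h₂ => exact h₁.imp h₂

/-- Under quantifier elimination, the 1-diagram of a tuple determines its `L`-type. -/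
lemma realize_of_diag1_eq {T : L.Theory} (hNT : N ⊨ T) (hqe : HasQE L T)
    {σ τ : Expansions L L' N} {n : ℕ} {a b : Fin n → N} (h : diag1 σ a = diag1 τ b)
    {χ : L.Formula (Fin n)} (hχ : χ.Realize a) : χ.Realize b := by
  rcases isEmpty_or_nonempty N with hN | hN
  · rwa [← Subsingleton.elim a b]
  obtain ⟨ψ, hψ, hT⟩ := hqe n χ
  have hiff : ∀ v : Fin n → N, χ.Realize v ↔ ψ.Realize v := fun v =>
    Formula.realize_iff.1 (hT (Theory.ModelType.of T N) v default)
  have hreal : ∀ (ρ : Expansions L L' N) (v : Fin n → N),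
      (LHom.sumInl : L →ᴸ L.sum L').onFormula ψ ∈ diag1 ρ v ↔ ψ.Realize v := by
    intro ρ v
    let := ρ.str
    have h₁ : ((LHom.sumInl : L →ᴸ L.sum L').onFormula ψ).Realize v ↔ ψ.Realize v :=
      LHom.realize_onFormula _ ψ
    exact ⟨fun h => h₁.1 h.1,
      fun h => ⟨h₁.2 h, Or.inl (isQF_onBoundedFormula _ hψ).isUniversal⟩⟩
  rw [hiff, ← hreal τ, ← h, hreal σ, ← hiff]
  exact hχ

lemma mem_DBasic_of_realize [Countable N] (hsat : IsSaturated L N) {T₀ : (L.sum L').Theory}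
    {n : ℕ} {a b : Fin n → N} (hab : ∀ χ : L.Formula (Fin n), χ.Realize a ↔ χ.Realize b)
    {σ : Expansions L L' N} (hσ : σ ∈ YSet L L' N T₀) {π : EQF L L' n} (hπ : π.RealizeAt σ a) :
    diag1 σ a ∈ DBasic L L' N T₀ b π := by
  obtain ⟨g, rfl⟩ := exists_equiv_of_realize_iff hsat a b hab
  exact ⟨conjExp g σ, conjExp_mem_YSet hσ g, (diag1_conjExp g σ a).symm,
    π.realizeAt_conjExp g σ hπ⟩

lemma mem_DBasic_iff [Countable N] {T : L.Theory} (hNT : N ⊨ T) (hqe : HasQE L T)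
    (hsat : IsSaturated L N) {T₀ : (L.sum L').Theory} {n : ℕ} {b : Fin n → N}
    {π : EQF L L' n} {d : Set ((L.sum L').Formula (Fin n))} (hd : d ∈ DSet L L' N T₀ b) :
    d ∈ DBasic L L' N T₀ b π ↔ d ∈ SBasic L L' N T₀ π := by
  constructor
  · rintro ⟨σ, hσ, rfl, hπ⟩
    exact ⟨σ, hσ, b, rfl, hπ⟩
  · rintro ⟨σ, hσ, a, rfl, hπ⟩
    obtain ⟨τ, -, h⟩ := hd
    exact mem_DBasic_of_realize hsat
      (fun χ => ⟨realize_of_diag1_eq hNT hqe h, realize_of_diag1_eq hNT hqe h.symm⟩) hσ hπ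

lemma pLEQF_realizeAt_iff {σ : Expansions L L' N} {n : ℕ} {a b : Fin n → N} :
    (pLEQF L L' N b).RealizeAt σ a ↔ ∀ χ : L.Formula (Fin n), χ.Realize a ↔ χ.Realize b := by
  have hrel : ∀ (χ : L.Formula (Fin n)) (y : Fin 0 → N),
      (Formula.relabel Sum.inl χ : L.Formula (Fin n ⊕ Fin 0)).Realize (Sum.elim a y) ↔
        χ.Realize a := fun χ y => by
    rw [Formula.realize_relabel, Sum.elim_comp_inl]
  constructor
  · rintro ⟨y, hy, -⟩
    have hy' : ∀ χ : L.Formula (Fin n), χ.Realize b → χ.Realize a := fun χ hχ =>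
      (hrel χ y).1 (hy _ ⟨χ, hχ, rfl⟩)
    refine fun χ => ⟨fun hχ => ?_, hy' χ⟩
    by_contra hn
    exact Formula.realize_not.1 (hy' χ.not (Formula.realize_not.2 hn)) hχ
  · intro h
    refine ⟨Fin.elim0, ?_, let := σ.str0; BoundedFormula.realize_top.2 trivial⟩
    rintro _ ⟨χ, hχ, rfl⟩
    exact (hrel χ _).2 ((h χ).2 hχ)

lemma DSet_eq_SBasic_pLEQF [Countable N] (hsat : IsSaturated L N) (T₀ : (L.sum L').Theory)
    {n : ℕ} (b : Fin n → N) : DSet L L' N T₀ b = SBasic L L' N T₀ (pLEQF L L' N b) := by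
  ext d
  constructor
  · rintro ⟨σ, hσ, rfl⟩
    exact ⟨σ, hσ, b, rfl, pLEQF_realizeAt_iff.2 fun _ => Iff.rfl⟩
  · rintro ⟨σ, hσ, a, rfl, h⟩
    obtain ⟨τ, hτ, h, -⟩ := mem_DBasic_of_realize hsat (pLEQF_realizeAt_iff.1 h) hσ h
    exact ⟨τ, hτ, h⟩

lemma DBasic_subset_DSet (T₀ : (L.sum L').Theory) {n : ℕ} (b : Fin n → N) (π : EQF L L' n) :
    DBasic L L' N T₀ b π ⊆ DSet L L' N T₀ b := by
  rintro d ⟨σ, hσ, rfl, -⟩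
  exact ⟨σ, hσ, rfl⟩

lemma subtype_image_val_eq_iff {α : Type} {A B : Set α} (h : B ⊆ A) (s : Set A) :
    Subtype.val '' s = B ↔ s = Subtype.val ⁻¹' B := by
  rw [← Subtype.val_injective.image_injective.eq_iff, Subtype.image_preimage_coe,
    Set.inter_eq_right.2 h]

/-- For a finite tuple `b` in `N` with parameter-free `L`-type `p↾L`,
there is a homeomorphism `h : D_b → [p↾L(x)]_S` sending `diag↾1(α, b)` to the
corresponding type, and for every existential quasifinite formula `π(x)` containing
`p↾L(x)`, the image under `h` of `[π(b)]_D` is `[π(x)]_S`. -/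
theorem statement6
    (T : L.Theory) (T₀ : (L.sum L').Theory)
    [Countable N] (hNT : N ⊨ T) (hTc : T.IsComplete) (hqe : HasQE L T)
    (hsmall : IsSmall L T) (hsat : IsSaturated L N)
    [Finite (Σ i, L'.Functions i)] [Finite (Σ i, L'.Relations i)]
    (hTT₀ : (LHom.sumInl : L →ᴸ L.sum L').onTheory T ⊆ T₀)
    (huniv : UniversalTheoryModulo L L' T T₀)
    (n : ℕ) (b : Fin n → N) :
    ∃ h : @Homeomorph ↥(DSet L L' N T₀ b) ↥(SBasic L L' N T₀ (pLEQF L L' N b))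
        (DTop L L' N T₀ b) (SBasicTop L L' N T₀ (pLEQF L L' N b)),
      (∀ d : ↥(DSet L L' N T₀ b), (h d).1 = d.1) ∧
      ∀ π : EQF L L' n,
        (∀ χ : L.Formula (Fin n), Formula.Realize (L := L) (M := N) χ b →
          Formula.relabel Sum.inl χ ∈ π.p) →
        h '' {d : ↥(DSet L L' N T₀ b) | ↑d ∈ DBasic L L' N T₀ b π} =
          {q : ↥(SBasic L L' N T₀ (pLEQF L L' N b)) | ↑q ∈ SBasic L L' N T₀ π} := by
  have hDS := DSet_eq_SBasic_pLEQF hsat T₀ b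
  let := DTop L L' N T₀ b
  let := SBasicTop L L' N T₀ (pLEQF L L' N b)
  let := STop L L' N T₀ n
  have hmem : ∀ (π : EQF L L' n) (d : ↥(DSet L L' N T₀ b)),
      d.1 ∈ DBasic L L' N T₀ b π ↔ d.1 ∈ SBasic L L' N T₀ π :=
    fun π d => mem_DBasic_iff hNT hqe hsat d.2
  refine ⟨{ toEquiv := Equiv.setCongr hDS, continuous_toFun := ?_, continuous_invFun := ?_ },
    fun d => rfl, fun π _ => ?_⟩
  · refine continuous_induced_rng.2 (continuous_generateFrom_iff.2 ?_)
    rintro s ⟨π, hs⟩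
    obtain rfl := (subtype_image_val_eq_iff (SBasic_subset_SSet T₀ π) s).1 hs
    exact TopologicalSpace.isOpen_generateFrom_of_mem
      ⟨π, (subtype_image_val_eq_iff (DBasic_subset_DSet T₀ b π) _).2
        (Set.ext fun d => (hmem π d).symm)⟩
  · refine continuous_generateFrom_iff.2 ?_
    rintro s ⟨π, hs⟩
    obtain rfl := (subtype_image_val_eq_iff (DBasic_subset_DSet T₀ b π) s).1 hs
    exact isOpen_induced_iff.2 ⟨Subtype.val ⁻¹' SBasic L L' N T₀ π,
      TopologicalSpace.isOpen_generateFrom_of_mem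
        ⟨π, (subtype_image_val_eq_iff (SBasic_subset_SSet T₀ π) _).2 rfl⟩,
      Set.ext fun q => (hmem π ((Equiv.setCongr hDS).symm q)).symm⟩
  · ext q
    constructor
    · rintro ⟨d, hd, rfl⟩
      exact (hmem π d).1 hd
    · intro hq
      exact ⟨(Equiv.setCongr hDS).symm q, (hmem π _).2 hq, rfl⟩

end GenExp
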